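/- arXiv:math/0410429 — 2 statements merged into one kernel-verified Lean document; each statement's English description precedes it below -/
import Mathlib

section
/- Partial self-similarity of the rule 150 total activity: for every m : ℕ and every r : ℕ with r < 4, X(8·m + r) = X(r) · X(m). -/
/-- Rule 150 elementary cellular automaton, started from a single seed at the origin. -/
def rule150 : ℕ → ℤ → ZMod 2
  | 0, n => if n = 0 then 1 else 0
  | t + 1, n => rule150 t (n - 1) + rule150 t n + rule150 t (n + 1)

/-- Total activity: the number of active sites at time `t`. -/
noncomputable def totalActivity (t : ℕ) : ℕ := {n : ℤ | rule150 t n = 1}.ncard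

theorem rule150_eq_zero_of_lt_abs (t : ℕ) (n : ℤ) (h : (t : ℤ) < |n|) : rule150 t n = 0 := by
  induction t generalizing n with
  | zero =>
    have : n ≠ 0 := by rintro rfl; simp at h
    simp [rule150, this]
  | succ t ih =>
    rw [rule150, ih (n - 1) (by grind), ih n (by grind), ih (n + 1) (by grind)]
    simp

theorem rule150_add_two (t : ℕ) (n : ℤ) :
    rule150 (t + 2) n = rule150 t (n - 2) + rule150 t n + rule150 t (n + 2) := by
  simp only [rule150]
  rw [show n - 1 - 1 = n - 2 by ring, show n - 1 + 1 = n by ring, show n + 1 - 1 = n by ring,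
    show n + 1 + 1 = n + 2 by ring]
  generalize rule150 t (n - 2) = a
  generalize rule150 t (n - 1) = b
  generalize rule150 t n = c
  generalize rule150 t (n + 1) = d
  generalize rule150 t (n + 2) = e
  revert a b c d e
  decide

theorem rule150_two_mul (t : ℕ) (k : ℤ) :
    rule150 (2 * t) (2 * k) = rule150 t k ∧ rule150 (2 * t) (2 * k + 1) = 0 := by
  induction t generalizing k with
  | zero => constructor <;> grind [rule150]
  | succ t ih =>
    rw [show 2 * (t + 1) = 2 * t + 2 by ring, rule150_add_two, rule150_add_two,
      show 2 * k - 2 = 2 * (k - 1) by ring, show 2 * k + 2 = 2 * (k + 1) by ring,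
      show 2 * k + 1 - 2 = 2 * (k - 1) + 1 by ring,
      show 2 * k + 1 + 2 = 2 * (k + 1) + 1 by ring]
    simp only [ih, rule150, add_zero, and_self]

theorem rule150_two_mul_eq_ite (t : ℕ) (n : ℤ) :
    rule150 (2 * t) n = if 2 ∣ n then rule150 t (n / 2) else 0 := by
  obtain ⟨k, rfl | rfl⟩ := Int.even_or_odd' n
  · simp [(rule150_two_mul t k).1]
  · rw [(rule150_two_mul t k).2, if_neg (by omega)]

theorem rule150_eight_mul (m : ℕ) (k j : ℤ) (hj : |j| ≤ 7) :
    rule150 (8 * m) (8 * k + j) = rule150 0 j * rule150 m k := by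
  rw [abs_le] at hj
  rw [show 8 * m = 2 * (2 * (2 * m)) by ring]
  simp only [rule150_two_mul_eq_ite, rule150]
  by_cases h : j = 0
  · subst h
    rw [if_pos (by omega), if_pos (by omega), if_pos (by omega),
      show (8 * k + 0) / 2 / 2 / 2 = k by omega]
    simp
  · rw [if_neg h, zero_mul]
    split_ifs <;> first | rfl | omega

theorem rule150_eight_mul_add (m r : ℕ) (k j : ℤ) (hj : |j| + r ≤ 7) :
    rule150 (8 * m + r) (8 * k + j) = rule150 r j * rule150 m k := by
  induction r generalizing j with
  | zero => exact rule150_eight_mul m k j (by simpa using hj)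
  | succ r ih =>
    rw [← add_assoc, rule150, rule150, add_sub_assoc, add_assoc (8 * k),
      ih (j - 1) (by grind), ih j (by grind), ih (j + 1) (by grind)]
    ring

theorem totalActivity_self_similarity (m r : ℕ) (hr : r < 4) :
    totalActivity (8 * m + r) = totalActivity r * totalActivity m := by
  have bound : ∀ j : ℤ, rule150 r j = 1 → |j| ≤ 3 := by
    intro j hj
    by_contra! h
    rw [rule150_eq_zero_of_lt_abs r j (by omega)] at hj
    exact zero_ne_one hj
  have mul_eq_one : ∀ a b : ZMod 2, a * b = 1 ↔ a = 1 ∧ b = 1 := by decide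
  unfold totalActivity
  rw [← Set.ncard_prod, ← Set.InjOn.ncard_image (f := fun p : ℤ × ℤ => 8 * p.2 + p.1)]
  · congr 1
    ext n
    simp only [Set.mem_ofPred_eq, Set.mem_image, Set.mem_prod, Prod.exists]
    constructor
    · intro hn
      refine ⟨n - 8 * ((n + 4) / 8), (n + 4) / 8, ?_, by ring⟩
      rw [← mul_eq_one, ← rule150_eight_mul_add, add_sub_cancel, hn]
      have : |n - 8 * ((n + 4) / 8)| ≤ 4 := by rw [abs_le]; omega
      omega
    · rintro ⟨j, k, h, rfl⟩
      have := bound j h.1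
      rw [rule150_eight_mul_add m r k j (by omega), mul_eq_one]
      exact h
  · rintro ⟨j, k⟩ h ⟨j', k'⟩ h' heq
    have hj := abs_le.1 (bound j h.1)
    have hj' := abs_le.1 (bound j' h'.1)
    simp only at heq
    rw [Prod.mk.injEq]
    omega
end

section
/- The block sums of the rule 150 total activity are rescaled Fibonacci numbers: for every n : ℕ, S(n) = 2^n · fib(n+2). -/
/-- Block sum of the total activity over the first `2 ^ n` time steps. -/
noncomputable def blockSum (n : ℕ) : ℕ := ∑ i ∈ Finset.range (2 ^ n), totalActivity i

theorem rule150_double (t : ℕ) :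
    ∀ k : ℤ, rule150 (2 * t) (2 * k) = rule150 t k ∧ rule150 (2 * t) (2 * k + 1) = 0 := by
  induction t with
  | zero =>
    refine fun k => ⟨?_, ?_⟩
    · simp [rule150]
    · simp only [rule150]
      rw [if_neg (by omega)]
  | succ t ih =>
    have step (k : ℤ) : rule150 (2 * t + 1) (2 * k) = rule150 t k ∧
        rule150 (2 * t + 1) (2 * k + 1) = rule150 t k + rule150 t (k + 1) := by
      constructor
      · rw [rule150, show 2 * k - 1 = 2 * (k - 1) + 1 by ring, (ih _).1, (ih _).2, (ih _).2]
        simp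
      · rw [rule150, show 2 * k + 1 - 1 = 2 * k by ring,
          show 2 * k + 1 + 1 = 2 * (k + 1) by ring, (ih _).1, (ih _).2, (ih _).1]
        simp
    intro k
    rw [show 2 * (t + 1) = 2 * t + 1 + 1 by ring]
    constructor
    · rw [rule150, show 2 * k - 1 = 2 * (k - 1) + 1 by ring, (step _).1, (step _).2, (step _).2,
        rule150, sub_add_cancel]
      generalize rule150 t (k - 1) = a
      generalize rule150 t k = b
      generalize rule150 t (k + 1) = c
      revert a b c; decide
    · rw [rule150, show 2 * k + 1 - 1 = 2 * k by ring,
        show 2 * k + 1 + 1 = 2 * (k + 1) by ring, (step _).1, (step _).2, (step _).1]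
      generalize rule150 t k = b
      generalize rule150 t (k + 1) = c
      revert b c; decide

theorem rule150_double_even (t : ℕ) (k : ℤ) : rule150 (2 * t) (2 * k) = rule150 t k :=
  (rule150_double t k).1

theorem rule150_double_odd (t : ℕ) (k : ℤ) : rule150 (2 * t) (2 * k + 1) = 0 :=
  (rule150_double t k).2

theorem rule150_double_add_one_even (t : ℕ) (k : ℤ) :
    rule150 (2 * t + 1) (2 * k) = rule150 t k := by
  rw [rule150, show 2 * k - 1 = 2 * (k - 1) + 1 by ring]
  simp only [rule150_double_even, rule150_double_odd, zero_add, add_zero]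

theorem rule150_double_add_one_odd (t : ℕ) (k : ℤ) :
    rule150 (2 * t + 1) (2 * k + 1) = rule150 t k + rule150 t (k + 1) := by
  rw [rule150, show 2 * k + 1 - 1 = 2 * k by ring, show 2 * k + 1 + 1 = 2 * (k + 1) by ring]
  simp only [rule150_double_even, rule150_double_odd, add_zero]

theorem rule150_eq_zero (t : ℕ) : ∀ n : ℤ, t < |n| → rule150 t n = 0 := by
  induction t with
  | zero =>
    intro n hn
    exact if_neg (abs_pos.1 (by simpa using hn))
  | succ t ih =>
    intro n hn
    push_cast at hn
    rw [rule150, ih, ih, ih] <;> grind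

theorem finite_rule150_eq_one (t : ℕ) : {n : ℤ | rule150 t n = 1}.Finite := by
  refine (Set.finite_Icc (-(t : ℤ)) t).subset fun n hn => ?_
  by_contra h
  have h0 := rule150_eq_zero t n (by rw [Set.mem_Icc, ← abs_le] at h; omega)
  rw [Set.mem_ofPred_eq, h0] at hn
  exact zero_ne_one hn

/-- The number of boundaries between active and inactive sites at time `t`. -/
noncomputable def boundaryCount (t : ℕ) : ℕ :=
  {n : ℤ | rule150 t n + rule150 t (n + 1) = 1}.ncard

theorem finite_rule150_add_eq_one (t : ℕ) :
    {n : ℤ | rule150 t n + rule150 t (n + 1) = 1}.Finite := by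
  refine ((finite_rule150_eq_one t).union
    ((finite_rule150_eq_one t).preimage (add_left_injective (1 : ℤ)).injOn)).subset fun n hn => ?_
  simp only [Set.mem_ofPred_eq, Set.mem_union, Set.mem_preimage] at hn ⊢
  generalize rule150 t n = a at *
  generalize rule150 t (n + 1) = b at *
  revert a b; decide

theorem Set.Finite.ncard_eq_even_add_odd {A : Set ℤ} (hA : A.Finite) :
    A.ncard = {k : ℤ | 2 * k ∈ A}.ncard + {k : ℤ | 2 * k + 1 ∈ A}.ncard := by
  have h2 : Function.Injective fun k : ℤ => 2 * k := fun a b h => by simpa using h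
  have h3 : Function.Injective fun k : ℤ => 2 * k + 1 := fun a b h => by simpa using h
  have hU : A = (fun k : ℤ => 2 * k) '' {k : ℤ | 2 * k ∈ A} ∪
      (fun k : ℤ => 2 * k + 1) '' {k : ℤ | 2 * k + 1 ∈ A} := by
    ext n
    simp only [Set.mem_union, Set.mem_image, Set.mem_ofPred_eq]
    constructor
    · intro hn
      obtain ⟨k, rfl | rfl⟩ := Int.even_or_odd' n
      · exact Or.inl ⟨k, hn, rfl⟩
      · exact Or.inr ⟨k, hn, rfl⟩
    · rintro (⟨k, hk, rfl⟩ | ⟨k, hk, rfl⟩) <;> exact hk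
  conv_lhs => rw [hU]
  have hE : {k : ℤ | 2 * k ∈ A}.Finite := hA.preimage h2.injOn
  have hO : {k : ℤ | 2 * k + 1 ∈ A}.Finite := hA.preimage h3.injOn
  rw [Set.ncard_union_eq _ (hE.image _) (hO.image _),
    Set.ncard_image_of_injective _ h2, Set.ncard_image_of_injective _ h3]
  rw [Set.disjoint_left]
  rintro _ ⟨a, -, rfl⟩ ⟨b, -, hb⟩
  simp only at hb
  omega

theorem ncard_rule150_shift (t : ℕ) :
    {n : ℤ | rule150 t (n + 1) = 1}.ncard = totalActivity t :=
  Set.ncard_preimage_of_injective_subset_range (s := {n : ℤ | rule150 t n = 1})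
    (add_left_injective (1 : ℤ)) fun n _ => ⟨n - 1, sub_add_cancel n 1⟩

theorem totalActivity_double (t : ℕ) : totalActivity (2 * t) = totalActivity t := by
  rw [totalActivity, (finite_rule150_eq_one _).ncard_eq_even_add_odd]
  simp [rule150_double_even, rule150_double_odd, totalActivity]

theorem totalActivity_double_add_one (t : ℕ) :
    totalActivity (2 * t + 1) = totalActivity t + boundaryCount t := by
  rw [totalActivity, (finite_rule150_eq_one _).ncard_eq_even_add_odd]
  simp only [Set.mem_ofPred_eq, rule150_double_add_one_even, rule150_double_add_one_odd,
    totalActivity, boundaryCount]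

theorem boundaryCount_double (t : ℕ) : boundaryCount (2 * t) = 2 * totalActivity t := by
  rw [boundaryCount, (finite_rule150_add_eq_one _).ncard_eq_even_add_odd,
    two_mul (totalActivity t)]
  simp only [Set.mem_ofPred_eq, show ∀ k : ℤ, 2 * k + 1 + 1 = 2 * (k + 1) from fun k => by ring,
    rule150_double_even, rule150_double_odd, add_zero, zero_add, ncard_rule150_shift]
  rfl

theorem boundaryCount_double_add_one (t : ℕ) :
    boundaryCount (2 * t + 1) = 2 * totalActivity t := by
  have h (a b : ZMod 2) : a + (a + b) = b ∧ a + b + b = a := by revert a b; decide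
  rw [boundaryCount, (finite_rule150_add_eq_one _).ncard_eq_even_add_odd,
    two_mul (totalActivity t)]
  simp only [Set.mem_ofPred_eq, show ∀ k : ℤ, 2 * k + 1 + 1 = 2 * (k + 1) from fun k => by ring,
    rule150_double_add_one_even, rule150_double_add_one_odd, h, ncard_rule150_shift]
  rw [totalActivity]

theorem Finset.sum_range_two_mul {M : Type*} [AddCommMonoid M] (f : ℕ → M) (n : ℕ) :
    ∑ i ∈ range (2 * n), f i = ∑ i ∈ range n, (f (2 * i) + f (2 * i + 1)) := by
  induction n with
  | zero => simp
  | succ n ih =>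
    rw [mul_add_one, sum_range_succ, sum_range_succ, ih, sum_range_succ, add_assoc]

theorem blockSum_zero : blockSum 0 = 1 := by
  simp [blockSum, totalActivity, rule150]

theorem blockSum_succ (n : ℕ) :
    blockSum (n + 1) = 2 * blockSum n + ∑ i ∈ Finset.range (2 ^ n), boundaryCount i := by
  rw [blockSum, pow_succ', Finset.sum_range_two_mul, blockSum, Finset.mul_sum,
    ← Finset.sum_add_distrib]
  refine Finset.sum_congr rfl fun i _ => ?_
  rw [totalActivity_double, totalActivity_double_add_one]
  ring

theorem sum_boundaryCount_succ (n : ℕ) :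
    ∑ i ∈ Finset.range (2 ^ (n + 1)), boundaryCount i = 4 * blockSum n := by
  rw [pow_succ', Finset.sum_range_two_mul, blockSum, Finset.mul_sum]
  refine Finset.sum_congr rfl fun i _ => ?_
  rw [boundaryCount_double, boundaryCount_double_add_one]
  ring

theorem blockSum_one : blockSum 1 = 4 := by
  have h0 : totalActivity 0 = 1 := by simpa [blockSum] using blockSum_zero
  have hb : boundaryCount 0 = 2 := by simpa [h0] using boundaryCount_double 0
  rw [blockSum_succ 0, blockSum_zero]
  simp [hb]

theorem blockSum_add_two (n : ℕ) : blockSum (n + 2) = 2 * blockSum (n + 1) + 4 * blockSum n := by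
  rw [blockSum_succ, sum_boundaryCount_succ]

theorem blockSum_eq_fib (n : ℕ) : blockSum n = 2 ^ n * Nat.fib (n + 2) := by
  induction n using Nat.twoStepInduction with
  | zero => simp [blockSum_zero]
  | one => simp [blockSum_one, Nat.fib]
  | more n h₀ h₁ =>
    rw [blockSum_add_two, h₀, h₁, Nat.fib_add_two (n := n + 2)]
    ring
end
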